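/- Let A : ℝⁿ → ℝ be continuously differentiable with gradient ∇A, and let π : ℝⁿ → ℝ be a continuous nonnegative function with compact support such that ∫_{ℝⁿ} π(a)·‖∇A(a)‖² da > 0. Define F(α) = ∫_{ℝⁿ} π(a)·A(a + α·∇A(a)) da. Then there exists δ > 0 such that F(α) > F(0) for all α ∈ (0, δ) and F(α) < F(0) for all α ∈ (−δ, 0). -/

import Mathlib

open MeasureTheory

open Filter Topology

/-- A function with positive derivative at a point is larger than its value there just to the right
and smaller just to the left. -/
lemma HasDerivAt.exists_lt_and_gt_of_pos {f : ℝ → ℝ} {f' x : ℝ} (hf : HasDerivAt f f' x)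
    (hf' : 0 < f') :
    ∃ δ > 0, (∀ y ∈ Set.Ioo x (x + δ), f x < f y) ∧ (∀ y ∈ Set.Ioo (x - δ) x, f y < f x) := by
  have hslope := (hasDerivAt_iff_tendsto_slope.1 hf).eventually (lt_mem_nhds hf')
  rw [eventually_nhdsWithin_iff, Metric.eventually_nhds_iff] at hslope
  obtain ⟨δ, hδ, h⟩ := hslope
  refine ⟨δ, hδ, fun y hy => ?_, fun y hy => ?_⟩
  · have hs := h (y := y) (by rw [Real.dist_eq, abs_lt]; constructor <;> linarith [hy.1, hy.2])
      hy.1.ne'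
    rw [slope_def_field, div_pos_iff] at hs
    rcases hs with hs | hs <;> linarith [hs.1, hs.2, hy.1]
  · have hs := h (y := y) (by rw [Real.dist_eq, abs_lt]; constructor <;> linarith [hy.1, hy.2])
      hy.2.ne
    rw [slope_def_field, div_pos_iff] at hs
    rcases hs with hs | hs <;> linarith [hs.1, hs.2, hy.2]

/-- The gradient of a continuously differentiable function is continuous. -/
lemma ContDiff.continuous_gradient {E : Type*} [NormedAddCommGroup E] [InnerProductSpace ℝ E]
    [CompleteSpace E] {A : E → ℝ} (hA : ContDiff ℝ 1 A) : Continuous (gradient A) :=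
  (InnerProductSpace.toDual ℝ E).symm.continuous.comp (hA.continuous_fderiv one_ne_zero)

/-- Differentiation under the integral sign for a weighted average, with compactly supported
weight, of a function displaced along its gradient. -/
lemma hasDerivAt_integral_mul_add_smul_gradient {E : Type*} [NormedAddCommGroup E]
    [InnerProductSpace ℝ E] [CompleteSpace E] [MeasurableSpace E] [OpensMeasurableSpace E]
    {μ : Measure E} [IsFiniteMeasureOnCompacts μ] {A π : E → ℝ} (hA : ContDiff ℝ 1 A)
    (hπc : Continuous π) (hπsupp : HasCompactSupport π) :
    HasDerivAt (fun α : ℝ => ∫ a, π a * A (a + α • gradient A a) ∂μ)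
      (∫ a, π a * ‖gradient A a‖ ^ 2 ∂μ) 0 := by
  have hg := hA.continuous_gradient
  have hAc := hA.continuous
  have hint : ∀ {f : E → ℝ}, Continuous f → Integrable (fun a => π a * f a) μ := fun hf =>
    (hπc.mul hf).integrable_of_hasCompactSupport hπsupp.mul_right
  obtain ⟨C, hC⟩ := ((isCompact_closedBall (0 : ℝ) 1).prod hπsupp).exists_bound_of_continuousOn
    (f := fun p : ℝ × E => inner ℝ (gradient A (p.2 + p.1 • gradient A p.2)) (gradient A p.2))
    (by fun_prop)
  have key := hasDerivAt_integral_of_dominated_loc_of_deriv_le (μ := μ) (x₀ := (0 : ℝ))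
    (F := fun α a => π a * A (a + α • gradient A a))
    (F' := fun α a => π a * inner ℝ (gradient A (a + α • gradient A a)) (gradient A a))
    (bound := fun a => ‖π a * C‖)
    (Metric.closedBall_mem_nhds (0 : ℝ) one_pos)
    (.of_forall fun α => (hint (by fun_prop)).aestronglyMeasurable)
    (hint (by fun_prop)) (hint (by fun_prop)).aestronglyMeasurable
    (.of_forall fun a α hα => ?_) (hint continuous_const).norm
    (.of_forall fun a α _ => ?_)
  · simpa [real_inner_self_eq_norm_sq] using key.2
  · by_cases ha : a ∈ tsupport π
    · rw [norm_mul, norm_mul]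
      gcongr
      exact (hC (α, a) ⟨hα, ha⟩).trans (le_abs_self C)
    · simp [image_eq_zero_of_notMem_tsupport ha]
  · have hline : HasDerivAt (fun α : ℝ => a + α • gradient A a) (gradient A a) α := by
      simpa using ((hasDerivAt_id α).smul_const (gradient A a)).const_add a
    have hd := ((hA.differentiable one_ne_zero) (a + α • gradient A a)).hasGradientAt
    have := hd.hasFDerivAt.comp_hasDerivAt α hline
    simpa only [InnerProductSpace.toDual_apply_apply] using! this.const_mul (π a)

/-- Sign conclusion of Proposition 1: if `∫ π ‖∇A‖² > 0`, then for sufficiently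
small `α > 0` the expected advantage `F(α)` exceeds `F(0)`, and for small
`α < 0` it is below `F(0)`. -/
theorem expected_advantage_locally_increasing {n : ℕ}
    (A : EuclideanSpace ℝ (Fin n) → ℝ) (hA : ContDiff ℝ 1 A)
    (π : EuclideanSpace ℝ (Fin n) → ℝ)
    (hπc : Continuous π) (hπ0 : ∀ a, 0 ≤ π a) (hπsupp : HasCompactSupport π)
    (hpos : 0 < ∫ a, π a * ‖gradient A a‖ ^ 2)
    (F : ℝ → ℝ)
    (hF : F = fun α : ℝ => ∫ a, π a * A (a + α • gradient A a)) :
    ∃ δ > 0, (∀ α ∈ Set.Ioo (0 : ℝ) δ, F 0 < F α) ∧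
      (∀ α ∈ Set.Ioo (-δ) (0 : ℝ), F α < F 0) := by
  have hderiv : HasDerivAt F (∫ a, π a * ‖gradient A a‖ ^ 2) 0 :=
    hF ▸ hasDerivAt_integral_mul_add_smul_gradient hA hπc hπsupp
  simpa only [zero_add, zero_sub] using hderiv.exists_lt_and_gt_of_pos hpos
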